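/- arXiv:1905.06155 — 3 statements merged into one kernel-verified Lean document; each statement's English description precedes it below -/
import Mathlib

section
/- For every real number a with 1/2 < a < 1, the measure (1−a)/2 · δ_{−1} + a · δ₀ + (1−a)/2 · δ₁ on ℝ admits a convolution inverse in the space of bounded signed measures on ℝ: there exists a bounded signed measure ν with ((1−a)/2 · δ_{−1} + a · δ₀ + (1−a)/2 · δ₁) ∗ ν = δ₀. -/
open MeasureTheory

/-- Convolution of two (finite) signed measures on `ℝ`, defined via the Jordan
decomposition and the convolution (pushforward of the product measure under addition)
of nonnegative finite measures. -/
noncomputable def sconvR (s t : SignedMeasure ℝ) : SignedMeasure ℝ :=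
  (s.toJordanDecomposition.posPart.conv t.toJordanDecomposition.posPart
    + s.toJordanDecomposition.negPart.conv t.toJordanDecomposition.negPart).toSignedMeasure
  - (s.toJordanDecomposition.posPart.conv t.toJordanDecomposition.negPart
    + s.toJordanDecomposition.negPart.conv t.toJordanDecomposition.posPart).toSignedMeasure

/-- The Dirac measure at a point of `ℝ`, as a signed measure. -/
noncomputable def diracR (x : ℝ) : SignedMeasure ℝ :=
  (Measure.dirac x).toSignedMeasure

open scoped ENNReal NNReal

namespace MeasureTheory.Measure

variable {M : Type*} [AddMonoid M] [MeasurableSpace M]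

lemma conv_univ [MeasurableAdd₂ M] (μ ν : Measure M) [SFinite ν] :
    (μ.conv ν) Set.univ = μ Set.univ * ν Set.univ := by
  rw [conv, map_apply (by fun_prop) MeasurableSet.univ, Set.preimage_univ, ← Set.univ_prod_univ,
    prod_prod]

lemma conv_sum [MeasurableAdd₂ M] {ι : Type*} [Countable ι] (μ : Measure M) (ν : ι → Measure M)
    [∀ i, SFinite (ν i)] : μ.conv (sum ν) = sum fun i ↦ μ.conv (ν i) := by
  simp only [conv]
  rw [prod_sum_right, map_sum (by fun_prop)]

/-- The convolution powers of a measure. -/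
noncomputable def convPow (μ : Measure M) : ℕ → Measure M
  | 0 => dirac 0
  | n + 1 => μ.conv (convPow μ n)

instance isFiniteMeasure_convPow [MeasurableAdd₂ M] (μ : Measure M) [IsFiniteMeasure μ] (n : ℕ) :
    IsFiniteMeasure (μ.convPow n) := by
  induction n with
  | zero => exact inferInstanceAs (IsFiniteMeasure (dirac 0))
  | succ n ih => exact inferInstanceAs (IsFiniteMeasure (μ.conv (μ.convPow n)))

lemma convPow_univ [MeasurableAdd₂ M] (μ : Measure M) [IsFiniteMeasure μ] (n : ℕ) :
    μ.convPow n Set.univ = μ Set.univ ^ n := by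
  induction n with
  | zero => simp [convPow]
  | succ n ih => rw [convPow, conv_univ, ih, pow_succ']

/-- The Neumann series of a measure of total mass less than one. -/
lemma exists_eq_dirac_add_conv [MeasurableAdd₂ M] (μ : Measure M) (hμ : μ Set.univ < 1) :
    ∃ P : Measure M, IsFiniteMeasure P ∧ P = dirac 0 + μ.conv P := by
  have : IsFiniteMeasure μ := ⟨hμ.trans ENNReal.one_lt_top⟩
  refine ⟨sum μ.convPow, ⟨?_⟩, ?_⟩
  · rw [sum_apply _ MeasurableSet.univ]
    simp only [convPow_univ]
    rw [ENNReal.tsum_geometric, ENNReal.inv_lt_top]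
    exact tsub_pos_of_lt hμ
  · rw [conv_sum]
    ext s hs
    rw [add_apply, sum_apply _ hs, sum_apply _ hs, tsum_eq_zero_add' ENNReal.summable]
    rfl

/-- If `μ` has total mass less than one, then `δ₀ + μ` has a convolution inverse, which is
a difference of two finite measures. -/
lemma exists_dirac_add_conv_eq [MeasurableAdd₂ M] (μ : Measure M) (hμ : μ Set.univ < 1) :
    ∃ P N : Measure M, IsFiniteMeasure P ∧ IsFiniteMeasure N ∧
      (dirac 0 + μ).conv P = (dirac 0 + μ).conv N + dirac 0 := by
  have : IsFiniteMeasure μ := ⟨hμ.trans ENNReal.one_lt_top⟩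
  obtain ⟨P, hP, h⟩ := exists_eq_dirac_add_conv (μ.conv μ) (by
    rw [conv_univ]
    exact mul_lt_one_of_nonneg_of_lt_one_left zero_le hμ hμ.le)
  refine ⟨P, μ.conv P, hP, inferInstance, ?_⟩
  rw [add_conv, add_conv, dirac_zero_conv, dirac_zero_conv, ← conv_assoc]
  nth_rewrite 1 [h]
  abel

end MeasureTheory.Measure

namespace MeasureTheory.SignedMeasure

lemma toJordanDecomposition_toSignedMeasure {α : Type*} [MeasurableSpace α] (μ : Measure α)
    [IsFiniteMeasure μ] :
    toJordanDecomposition μ.toSignedMeasure =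
      ⟨μ, 0, Measure.MutuallySingular.zero_right⟩ :=
  toJordanDecomposition_eq (by simp [JordanDecomposition.toSignedMeasure])

end MeasureTheory.SignedMeasure

lemma sconvR_toSignedMeasure_sub (μ P N : Measure ℝ) [IsFiniteMeasure μ] [IsFiniteMeasure P]
    [IsFiniteMeasure N] :
    sconvR μ.toSignedMeasure (P.toSignedMeasure - N.toSignedMeasure) =
      (μ.conv P).toSignedMeasure - (μ.conv N).toSignedMeasure := by
  set s := P.toSignedMeasure - N.toSignedMeasure with hs
  have h : s.toJordanDecomposition.posPart + N = P + s.toJordanDecomposition.negPart := by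
    rw [← Measure.toSignedMeasure_eq_toSignedMeasure_iff, Measure.toSignedMeasure_add,
      Measure.toSignedMeasure_add, ← sub_eq_sub_iff_add_eq_add, ← hs]
    exact s.toSignedMeasure_toJordanDecomposition
  have hconv := congrArg μ.conv h
  rw [Measure.conv_add, Measure.conv_add, ← Measure.toSignedMeasure_eq_toSignedMeasure_iff,
    Measure.toSignedMeasure_add, Measure.toSignedMeasure_add, ← sub_eq_sub_iff_add_eq_add] at hconv
  simpa [sconvR, SignedMeasure.toJordanDecomposition_toSignedMeasure] using hconv

/-- For `1/2 < a < 1`, the measure `(1-a)/2 δ₋₁ + a δ₀ + (1-a)/2 δ₁` has a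
convolution inverse among bounded signed measures on `ℝ`. -/
theorem exists_inverse_symmetric_three_point (a : ℝ) (ha : 1 / 2 < a) (ha' : a < 1) :
    ∃ ν : SignedMeasure ℝ,
      sconvR (((1 - a) / 2) • diracR (-1) + a • diracR 0 + ((1 - a) / 2) • diracR 1) ν =
        diracR 0 := by
  lift a to ℝ≥0 using by linarith
  obtain ⟨b, hb⟩ : ∃ b : ℝ≥0, (b : ℝ) = (1 - a) / 2 := ⟨⟨(1 - a) / 2, by linarith⟩, rfl⟩
  have ha0 : a ≠ 0 := by rintro rfl; norm_num at ha
  let ρ : Measure ℝ := (a⁻¹ * b) • (Measure.dirac (-1) + Measure.dirac 1)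
  have hρ : ρ Set.univ < 1 := by
    have : a⁻¹ * b * 2 < 1 := by
      rw [mul_assoc, inv_mul_lt_iff₀ (pos_iff_ne_zero.2 ha0), ← NNReal.coe_lt_coe]
      push_cast
      linarith
    simp only [ρ, Measure.smul_apply, Measure.add_apply, measure_univ, ENNReal.smul_def,
      smul_eq_mul, one_add_one_eq_two]
    exact_mod_cast this
  obtain ⟨P, N, hP, hN, h⟩ := Measure.exists_dirac_add_conv_eq ρ hρ
  have hμ : (((1 - a) / 2 : ℝ)) • diracR (-1) + (a : ℝ) • diracR 0 + ((1 - a) / 2 : ℝ) • diracR 1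
      = (a • (Measure.dirac 0 + ρ)).toSignedMeasure := by
    simp only [ρ, ← hb, diracR, Measure.toSignedMeasure_smul, Measure.toSignedMeasure_add,
      smul_add, smul_smul, mul_inv_cancel_left₀ ha0, NNReal.smul_def]
    abel
  refine ⟨(a⁻¹ • P).toSignedMeasure - (a⁻¹ • N).toSignedMeasure, ?_⟩
  have hconv (Q : Measure ℝ) [IsFiniteMeasure Q] :
      (a • (Measure.dirac 0 + ρ)).conv (a⁻¹ • Q) = (Measure.dirac 0 + ρ).conv Q := by
    change ((a : ℝ≥0∞) • (Measure.dirac 0 + ρ)).conv (((a⁻¹ : ℝ≥0) : ℝ≥0∞) • Q) = _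
    rw [Measure.conv_smul_left, Measure.conv_smul_right, smul_smul, ← ENNReal.coe_mul,
      mul_inv_cancel₀ ha0, ENNReal.coe_one, one_smul]
  rw [hμ, sconvR_toSignedMeasure_sub, Measure.toSignedMeasure_congr (hconv P),
    Measure.toSignedMeasure_congr (hconv N), Measure.toSignedMeasure_congr h,
    Measure.toSignedMeasure_add, add_sub_cancel_left, diracR]
end

section
/- Let μ : ℤ → ℝ be the sequence with μ(−1) = 1/4, μ(0) = 1/2, μ(1) = 1/4 and μ(n) = 0 otherwise, and let ν : ℤ → ℝ be the sequence with ν(n) = 2·|n|·(−1)^{|n|+1} for all n ∈ ℤ (so ν(0) = 0). Then for every finitely supported sequence f : ℤ → ℝ and every m ∈ ℤ, Σ_{n ∈ ℤ} (f ∗ μ)(n) · ν(m − n) = f(m); that is, (f ∗ μ) ∗ ν = f. (Each sum is finite because f ∗ μ is finitely supported.) -/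
/-- Convolution of two sequences on `ℤ` (a finite sum whenever the first factor
is finitely supported). -/
noncomputable def zconv (a b : ℤ → ℝ) : ℤ → ℝ := fun m => ∑ᶠ k : ℤ, a k * b (m - k)

/-- The measure `μ = 1/4 δ₋₁ + 1/2 δ₀ + 1/4 δ₁` as a sequence on `ℤ`. -/
noncomputable def muSeq : ℤ → ℝ := fun n =>
  if n = -1 then 1 / 4 else if n = 0 then 1 / 2 else if n = 1 then 1 / 4 else 0

/-- The strange inverse `ν` with `ν(n) = 2|n|(-1)^{|n|+1}`. -/
noncomputable def nuSeq : ℤ → ℝ := fun n => 2 * (n.natAbs : ℝ) * (-1) ^ (n.natAbs + 1)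

/-- Convolution with `muSeq` is a weighted average over neighbours. -/
lemma zconv_muSeq (f : ℤ → ℝ) (n : ℤ) :
    zconv f muSeq n = 1 / 4 * f (n + 1) + 1 / 2 * f n + 1 / 4 * f (n - 1) := by
  unfold zconv
  rw [finsum_eq_sum_of_support_subset (s := {n + 1, n, n - 1})]
  · rw [Finset.sum_insert (by simp; omega), Finset.sum_insert (by simp; omega),
      Finset.sum_singleton]
    simp [muSeq]
    ring
  · intro k hk
    by_contra hc
    simp only [Finset.coe_insert, Finset.coe_singleton, Set.mem_insert_iff,
      Set.mem_singleton_iff, not_or] at hc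
    apply hk
    have h : muSeq (n - k) = 0 := by
      unfold muSeq
      rw [if_neg (by omega), if_neg (by omega), if_neg (by omega)]
    simp [h]

lemma nuSeq_neg (n : ℤ) : nuSeq (-n) = nuSeq n := by
  simp [nuSeq]

lemma nuSeq_natCast (n : ℕ) : nuSeq n = 2 * n * (-1) ^ (n + 1) := by
  simp [nuSeq]

lemma nuSeq_second_difference_succ (k : ℕ) :
    nuSeq ((k : ℤ) + 1 + 1) + 2 * nuSeq ((k : ℤ) + 1) + nuSeq (k : ℤ) = 0 := by
  have h₁ := nuSeq_natCast (k + 1)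
  have h₂ := nuSeq_natCast (k + 1 + 1)
  push_cast at h₁ h₂
  rw [h₁, h₂, nuSeq_natCast]
  ring

/-- `nuSeq` is a fundamental solution of the averaging operator of `muSeq`. -/
lemma nuSeq_average (n : ℤ) :
    1 / 4 * nuSeq (n + 1) + 1 / 2 * nuSeq n + 1 / 4 * nuSeq (n - 1) =
      if n = 0 then 1 else 0 := by
  obtain ⟨k, rfl | rfl⟩ := n.eq_nat_or_neg
  all_goals rcases k with _ | k
  · norm_num [nuSeq]
  · rw [if_neg (by omega)]
    have h := nuSeq_second_difference_succ k
    push_cast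
    rw [add_sub_cancel_right]
    linarith
  · norm_num [nuSeq]
  · rw [if_neg (by omega)]
    have h := nuSeq_second_difference_succ k
    rw [← nuSeq_neg (-_ + 1), ← nuSeq_neg (-_ - 1), nuSeq_neg (((k + 1 : ℕ) : ℤ))]
    rw [show -(-((k + 1 : ℕ) : ℤ) + 1) = k by push_cast; ring,
      show -(-((k + 1 : ℕ) : ℤ) - 1) = k + 1 + 1 by push_cast; ring]
    push_cast
    linarith

/-- For every finitely supported `f : ℤ → ℝ`, `(f ∗ μ) ∗ ν = f`. -/
theorem strange_inverse_recovers {f : ℤ → ℝ} (hf : (Function.support f).Finite) (m : ℤ) :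
    ∑ᶠ n : ℤ, (zconv f muSeq) n * nuSeq (m - n) = f m := by
  have hfin (g : ℤ → ℝ) : (Function.support fun n => f n * g n).Finite :=
    hf.subset (Function.support_mul_subset_left f g)
  have hshift (c : ℤ) (g : ℤ → ℝ) : (Function.support fun n => f (n + c) * g n).Finite := by
    have h := (hfin fun n => g (n - c)).preimage (add_left_injective c).injOn
    refine h.subset fun n hn => ?_
    simpa using hn
  have hsum (c : ℤ) (g : ℤ → ℝ) : ∑ᶠ n, f (n + c) * g n = ∑ᶠ n, f n * g (n - c) := by
    rw [← finsum_comp_equiv (Equiv.addRight c) (f := fun n => f n * g (n - c))]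
    simp
  calc ∑ᶠ n : ℤ, (zconv f muSeq) n * nuSeq (m - n)
      = ∑ᶠ n : ℤ, (f (n + 1) * (1 / 4 * nuSeq (m - n)) + f n * (1 / 2 * nuSeq (m - n)) +
          f (n + -1) * (1 / 4 * nuSeq (m - n))) := by
        refine finsum_congr fun n => ?_
        rw [zconv_muSeq, ← sub_eq_add_neg]
        ring
    _ = ∑ᶠ n : ℤ, (f n * (1 / 4 * nuSeq (m - (n - 1))) + f n * (1 / 2 * nuSeq (m - n)) +
          f n * (1 / 4 * nuSeq (m - (n - -1)))) := by
        rw [finsum_add_distrib (((hshift 1 _).union (hfin _)).subset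
            (Function.support_add _ _)) (hshift (-1) _),
          finsum_add_distrib (hshift 1 _) (hfin _), hsum, hsum,
          finsum_add_distrib (((hfin _).union (hfin _)).subset
            (Function.support_add _ _)) (hfin _),
          finsum_add_distrib (hfin _) (hfin _)]
    _ = ∑ᶠ n : ℤ, if n = m then f n else 0 := by
        refine finsum_congr fun n => ?_
        have h := nuSeq_average (m - n)
        rw [← mul_add, ← mul_add, show m - (n - 1) = m - n + 1 by ring,
          show m - (n - -1) = m - n - 1 by ring, h]
        simp [sub_eq_zero, eq_comm]
    _ = f m := by
        rw [finsum_eq_single _ m fun n hn => if_neg hn, if_pos rfl]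
end

section
/- Let a : ℤ → ℝ be the sequence with a(0) = a(1) = 1/2 and a(n) = 0 otherwise, and let H : ℤ → ℝ be the sequence with H(n) = (−1)^n for n ≥ 0 and H(n) = (−1)^{n+1} for n ≤ −1 (so H = ⋯ − δ_{−4} + δ_{−3} − δ_{−2} + δ_{−1} + δ₀ − δ₁ + δ₂ − δ₃ + ⋯). Then for every finitely supported sequence f : ℤ → ℝ and every m ∈ ℤ, Σ_{n ∈ ℤ} (f ∗ a)(n) · H(m − n) = f(m); that is, (f ∗ (1/2)(δ₀ + δ₁)) ∗ H = f. -/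
/-- The sequence `1/2 (δ₀ + δ₁)` on `ℤ`. -/
noncomputable def aSeq : ℤ → ℝ := fun n =>
  if n = 0 then 1 / 2 else if n = 1 then 1 / 2 else 0

/-- The two-sided sequence `H` with `H(n) = (-1)^n` for `n ≥ 0` and
`H(n) = (-1)^{n+1}` for `n ≤ -1`, i.e.
`H = ⋯ - δ₋₄ + δ₋₃ - δ₋₂ + δ₋₁ + δ₀ - δ₁ + δ₂ - δ₃ + ⋯`. -/
noncomputable def HSeq : ℤ → ℝ := fun n =>
  if 0 ≤ n then (-1 : ℝ) ^ n.natAbs else (-1 : ℝ) ^ (n.natAbs + 1)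

theorem HSeq_add_HSeq_sub_one (n : ℤ) : HSeq n + HSeq (n - 1) = if n = 0 then 2 else 0 := by
  unfold HSeq
  rcases lt_trichotomy n 0 with h | rfl | h
  · have hn : (n - 1).natAbs = n.natAbs + 1 := by omega
    rw [if_neg (by omega), if_neg (by omega), if_neg h.ne, hn]
    ring
  · norm_num
  · have hn : n.natAbs = (n - 1).natAbs + 1 := by omega
    rw [if_pos h.le, if_pos (by omega), if_neg h.ne', hn]
    ring

theorem zconv_aSeq (f : ℤ → ℝ) (n : ℤ) : zconv f aSeq n = (f n + f (n - 1)) / 2 := by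
  have hsupp : (Function.support fun k => f k * aSeq (n - k)) ⊆ ({n, n - 1} : Finset ℤ) := by
    intro k hk
    by_contra hmem
    simp only [Finset.coe_insert, Finset.coe_singleton, Set.mem_insert_iff,
      Set.mem_singleton_iff, not_or] at hmem
    refine hk ?_
    simp only [aSeq]
    rw [if_neg (by omega), if_neg (by omega), mul_zero]
  rw [zconv, finsum_eq_sum_of_support_subset _ hsupp, Finset.sum_pair (by omega)]
  simp only [aSeq, sub_self, sub_sub_cancel]
  norm_num
  ring

/-- For every finitely supported `f : ℤ → ℝ`, `(f ∗ (1/2)(δ₀ + δ₁)) ∗ H = f`. -/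
theorem H_inverse_recovers {f : ℤ → ℝ} (hf : (Function.support f).Finite) (m : ℤ) :
    ∑ᶠ n : ℤ, (zconv f aSeq) n * HSeq (m - n) = f m := by
  have hfin (g : ℤ → ℝ) : (Function.support fun n => f n * g n).Finite :=
    hf.subset fun n hn => left_ne_zero_of_mul hn
  have hfin_shift : (Function.support fun n => f (n - 1) * (HSeq (m - n) / 2)).Finite :=
    (hf.preimage (sub_left_injective (b := (1 : ℤ))).injOn).subset
      fun n hn => left_ne_zero_of_mul hn
  have hshift : ∑ᶠ n : ℤ, f (n - 1) * (HSeq (m - n) / 2)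
      = ∑ᶠ n : ℤ, f n * (HSeq (m - n - 1) / 2) := by
    rw [← finsum_comp_equiv (Equiv.addRight (1 : ℤ))]
    simp only [Equiv.coe_addRight, add_sub_cancel_right, sub_sub]
  calc ∑ᶠ n : ℤ, (zconv f aSeq) n * HSeq (m - n)
      = ∑ᶠ n : ℤ, (f n * (HSeq (m - n) / 2) + f (n - 1) * (HSeq (m - n) / 2)) :=
        finsum_congr fun n => by rw [zconv_aSeq]; ring
    _ = ∑ᶠ n : ℤ, (f n * (HSeq (m - n) / 2) + f n * (HSeq (m - n - 1) / 2)) := by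
        rw [finsum_add_distrib (hfin _) hfin_shift, hshift,
          ← finsum_add_distrib (hfin _) (hfin _)]
    _ = ∑ᶠ n : ℤ, if n = m then f n else 0 := finsum_congr fun n => by
        rw [← mul_add, ← add_div, HSeq_add_HSeq_sub_one]
        simp only [sub_eq_zero, eq_comm (a := m)]
        split_ifs <;> simp
    _ = f m := by
        rw [finsum_eq_single _ m fun n hn => if_neg hn, if_pos rfl]
end
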